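/- With $A$, $C$, $F$, and $W$ as above, if additionally the pair $(A,C)$ is observable and all $\lambda_j>0$, $\gamma_s>0$, $\mu_j>0$, then the zero solution of $\dot e = (A-FC)e$ is asymptotically stable; equivalently, every eigenvalue of $A-FC$ has negative real part, and consequently every solution satisfies $\|e(t)\| \to 0$ exponentially as $t\to\infty$. -/

import Mathlib

def blockA (N : ℕ) (lam : Fin N → ℝ) : Matrix (Fin N × Fin 2) (Fin N × Fin 2) ℝ :=
  Matrix.of fun p q =>
    if p.1 = q.1 then
      if p.2 = 0 ∧ q.2 = 1 then 1
      else if p.2 = 1 ∧ q.2 = 0 then -lam p.1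
      else 0
    else 0

def outC (N r : ℕ) (c : Fin (r + 1) → Fin N → ℝ) : Matrix (Fin (r + 1)) (Fin N × Fin 2) ℝ :=
  Matrix.of fun s q => if q.2 = 0 then c s q.1 else 0

noncomputable def gainF (N r : ℕ) (lam : Fin N → ℝ) (c : Fin (r + 1) → Fin N → ℝ)
    (γ : Fin (r + 1) → ℝ) (μ : Fin N → ℝ) : Matrix (Fin N × Fin 2) (Fin (r + 1)) ℝ :=
  Matrix.of fun q s => if q.2 = 0 then γ s * c s q.1 / (lam q.1 * μ q.1) else 0

noncomputable def quadW (N : ℕ) (lam μ : Fin N → ℝ) (e : Fin N × Fin 2 → ℝ) : ℝ :=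
  (1 / 2) * ∑ j : Fin N, μ j * ((e (j, 1)) ^ 2 + lam j * (e (j, 0)) ^ 2)

def obsMat (N r : ℕ) (lam : Fin N → ℝ) (c : Fin (r + 1) → Fin N → ℝ) :
    Matrix (Fin (2 * N) × Fin (r + 1)) (Fin N × Fin 2) ℝ :=
  Matrix.of fun ns q => (outC N r c * (blockA N lam) ^ (ns.1 : ℕ)) ns.2 q

theorem aux_ratio {E : Type*} [NormedAddCommGroup E] [NormedSpace ℝ E] [FiniteDimensional ℝ E]
    (f g : E → ℝ) (hf : Continuous f) (hg : Continuous g)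
    (hfh : ∀ (a : ℝ) x, f (a • x) = a ^ 2 * f x) (hgh : ∀ (a : ℝ) x, g (a • x) = a ^ 2 * g x)
    (hpos : ∀ x, x ≠ 0 → 0 < f x) :
    ∃ K : ℝ, (K = 0 ∨ ∃ x, x ≠ 0 ∧ K = g x / f x) ∧ ∀ x, g x ≤ K * f x := by
  have hf0 : f 0 = 0 := by simpa using hfh 0 0
  have hg0 : g 0 = 0 := by simpa using hgh 0 0
  have : ProperSpace E := FiniteDimensional.proper ℝ E
  by_cases hne : (Metric.sphere (0 : E) 1).Nonempty
  · have hcont : ContinuousOn (fun x => g x / f x) (Metric.sphere (0 : E) 1) := by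
      apply ContinuousOn.div hg.continuousOn hf.continuousOn
      intro x hx
      exact (hpos x (ne_zero_of_mem_unit_sphere ⟨x, hx⟩)).ne'
    obtain ⟨x0, hx0, hmax⟩ := (isCompact_sphere (0 : E) 1).exists_isMaxOn hne hcont
    refine ⟨g x0 / f x0, Or.inr ⟨x0, ne_zero_of_mem_unit_sphere ⟨x0, hx0⟩, rfl⟩, ?_⟩
    intro x
    by_cases hx : x = 0
    · subst hx; simp [hf0, hg0]
    · have hn : ‖x‖ ≠ 0 := norm_ne_zero_iff.mpr hx
      have hmem : (‖x‖⁻¹ • x) ∈ Metric.sphere (0 : E) 1 := by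
        simp [norm_smul, hn]
      have h := hmax hmem
      simp only [Set.mem_ofPred_eq, hfh, hgh] at h
      rw [mul_div_mul_left _ _ (by positivity)] at h
      rwa [div_le_iff₀ (hpos x hx)] at h
  · refine ⟨0, Or.inl rfl, ?_⟩
    intro x
    by_cases hx : x = 0
    · subst hx; simp [hf0, hg0]
    · exfalso
      apply hne
      have hn : ‖x‖ ≠ 0 := norm_ne_zero_iff.mpr hx
      exact ⟨‖x‖⁻¹ • x, by simp [norm_smul, hn]⟩

noncomputable def clB (N r : ℕ) (lam μ : Fin N → ℝ) (c : Fin (r + 1) → Fin N → ℝ)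
    (γ : Fin (r + 1) → ℝ) : Matrix (Fin N × Fin 2) (Fin N × Fin 2) ℝ :=
  blockA N lam - gainF N r lam c γ μ * outC N r c

def quadG (N : ℕ) (lam μ : Fin N → ℝ) (x y : Fin N × Fin 2 → ℝ) : ℝ :=
  ∑ j : Fin N, μ j * (x (j, 1) * y (j, 1) + lam j * (x (j, 0) * y (j, 0)))

theorem blockA_mulVec_zero (N : ℕ) (lam : Fin N → ℝ) (x : Fin N × Fin 2 → ℝ) (j : Fin N) :
    (blockA N lam).mulVec x (j, 0) = x (j, 1) := by
  simp [blockA, Matrix.mulVec, dotProduct, Fintype.sum_prod_type]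

theorem blockA_mulVec_one (N : ℕ) (lam : Fin N → ℝ) (x : Fin N × Fin 2 → ℝ) (j : Fin N) :
    (blockA N lam).mulVec x (j, 1) = -lam j * x (j, 0) := by
  simp [blockA, Matrix.mulVec, dotProduct, Fintype.sum_prod_type]

theorem outC_mulVec (N r : ℕ) (c : Fin (r + 1) → Fin N → ℝ) (x : Fin N × Fin 2 → ℝ)
    (s : Fin (r + 1)) : (outC N r c).mulVec x s = ∑ j, c s j * x (j, 0) := by
  simp [outC, Matrix.mulVec, dotProduct, Fintype.sum_prod_type]

theorem clB_mulVec (N r : ℕ) (lam μ : Fin N → ℝ) (c : Fin (r + 1) → Fin N → ℝ)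
    (γ : Fin (r + 1) → ℝ) (x : Fin N × Fin 2 → ℝ) :
    (clB N r lam μ c γ).mulVec x = (blockA N lam).mulVec x
      - (gainF N r lam c γ μ).mulVec ((outC N r c).mulVec x) := by
  rw [clB, Matrix.sub_mulVec, Matrix.mulVec_mulVec]

theorem quadG_clB (N r : ℕ) (lam μ : Fin N → ℝ) (c : Fin (r + 1) → Fin N → ℝ)
    (γ : Fin (r + 1) → ℝ) (hlam : ∀ j, 0 < lam j) (hμ : ∀ j, 0 < μ j)
    (x : Fin N × Fin 2 → ℝ) :
    quadG N lam μ x ((clB N r lam μ c γ).mulVec x)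
      = -∑ s, γ s * ((outC N r c).mulVec x s) ^ 2 := by
  have h1 : ∀ j, μ j * (x (j, 1) * (clB N r lam μ c γ).mulVec x (j, 1)
      + lam j * (x (j, 0) * (clB N r lam μ c γ).mulVec x (j, 0)))
      = -∑ s, (c s j * x (j, 0)) * (γ s * (outC N r c).mulVec x s) := by
    intro j
    rw [clB_mulVec]
    simp only [Pi.sub_apply, blockA_mulVec_zero, blockA_mulVec_one]
    have e1 : (gainF N r lam c γ μ).mulVec ((outC N r c).mulVec x) (j, 1) = 0 := by
      simp [gainF, Matrix.mulVec, dotProduct]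
    have e0 : (gainF N r lam c γ μ).mulVec ((outC N r c).mulVec x) (j, 0)
        = (∑ s, c s j * (γ s * (outC N r c).mulVec x s)) / (lam j * μ j) := by
      rw [Finset.sum_div]
      conv_lhs => rw [Matrix.mulVec, dotProduct]
      refine Finset.sum_congr rfl fun s _ => ?_
      simp only [gainF, Matrix.of_apply, if_true]
      ring
    rw [e1, e0]
    have e2 : ∑ s, (c s j * x (j, 0)) * (γ s * (outC N r c).mulVec x s)
        = x (j, 0) * ∑ s, c s j * (γ s * (outC N r c).mulVec x s) := by
      rw [Finset.mul_sum]
      refine Finset.sum_congr rfl fun s _ => by ring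
    rw [e2]
    have := (hlam j).ne'
    have := (hμ j).ne'
    field_simp
    ring
  rw [quadG, Finset.sum_congr rfl fun j _ => h1 j, Finset.sum_neg_distrib, Finset.sum_comm]
  congr 1
  refine Finset.sum_congr rfl fun s _ => ?_
  rw [← Finset.sum_mul, ← outC_mulVec]
  ring

theorem quadW_eq (N : ℕ) (lam μ : Fin N → ℝ) (x : Fin N × Fin 2 → ℝ) :
    quadG N lam μ x x = 2 * quadW N lam μ x := by
  simp only [quadG, quadW, ← mul_assoc]
  norm_num
  refine Finset.sum_congr rfl fun s _ => by ring

theorem quadW_pos (N : ℕ) (lam μ : Fin N → ℝ) (hlam : ∀ j, 0 < lam j) (hμ : ∀ j, 0 < μ j)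
    (x : Fin N × Fin 2 → ℝ) (hx : x ≠ 0) : 0 < quadW N lam μ x := by
  obtain ⟨⟨j, i⟩, hj⟩ := Function.ne_iff.mp hx
  simp only [Pi.zero_apply] at hj
  rw [quadW]
  refine mul_pos (by norm_num) (Finset.sum_pos' (fun k _ => ?_) ⟨j, Finset.mem_univ _, ?_⟩)
  · have := hlam k
    have := hμ k
    positivity
  · have h1 := hlam j
    have h2 := hμ j
    apply mul_pos h2
    fin_cases i
    · have : 0 < x (j, 0) ^ 2 := by have : x (j, 0) ≠ 0 := hj
                                    positivity
      positivity
    · have : 0 < x (j, 1) ^ 2 := by have : x (j, 1) ≠ 0 := hj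
                                    positivity
      positivity

theorem quadW_nonneg (N : ℕ) (lam μ : Fin N → ℝ) (hlam : ∀ j, 0 < lam j) (hμ : ∀ j, 0 < μ j)
    (x : Fin N × Fin 2 → ℝ) : 0 ≤ quadW N lam μ x := by
  by_cases hx : x = 0
  · simp [hx, quadW]
  · exact (quadW_pos N lam μ hlam hμ x hx).le

theorem obs_inj (N r : ℕ) (lam : Fin N → ℝ) (c : Fin (r + 1) → Fin N → ℝ)
    (hobs : (obsMat N r lam c).rank = 2 * N) (x : Fin N × Fin 2 → ℝ)
    (hx : ∀ k : ℕ, (outC N r c * blockA N lam ^ k).mulVec x = 0) : x = 0 := by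
  have h1 : (obsMat N r lam c).mulVecLin x = 0 := by
    ext ⟨k, s⟩
    exact congrFun (hx k) s
  have h2 := LinearMap.finrank_range_add_finrank_ker (obsMat N r lam c).mulVecLin
  rw [← Matrix.rank, hobs] at h2
  simp only [Module.finrank_fintype_fun_eq_card, Fintype.card_prod, Fintype.card_fin] at h2
  have h3 : Module.finrank ℝ (LinearMap.ker (obsMat N r lam c).mulVecLin) = 0 := by omega
  rw [Submodule.finrank_eq_zero] at h3
  have : x ∈ LinearMap.ker (obsMat N r lam c).mulVecLin := h1
  rw [h3] at this
  simpa using this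

theorem spec_part (N r : ℕ) (lam μ : Fin N → ℝ) (c : Fin (r + 1) → Fin N → ℝ)
    (γ : Fin (r + 1) → ℝ)
    (hlam : ∀ j, 0 < lam j) (hμ : ∀ j, 0 < μ j) (hγ : ∀ s, 0 < γ s)
    (hobs : (obsMat N r lam c).rank = 2 * N) (z : ℂ)
    (hz : z ∈ spectrum ℂ ((clB N r lam μ c γ).map (algebraMap ℝ ℂ))) : z.re < 0 := by
  rw [← Matrix.spectrum_toLin', ← Module.End.hasEigenvalue_iff_mem_spectrum] at hz
  obtain ⟨v, hv⟩ := hz.exists_hasEigenvector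
  have hv0 := hv.2
  have hv1 := hv.apply_eq_smul
  rw [Matrix.toLin'_apply] at hv1
  set B := clB N r lam μ c γ with hB
  set u : Fin N × Fin 2 → ℝ := fun i => (v i).re with hu
  set w : Fin N × Fin 2 → ℝ := fun i => (v i).im with hw
  have hBu : B.mulVec u = z.re • u - z.im • w := by
    ext i
    have := congrArg Complex.re (congrFun hv1 i)
    simpa [Matrix.mulVec, dotProduct, hu, hw] using this
  have hBw : B.mulVec w = z.re • w + z.im • u := by
    ext i
    have := congrArg Complex.im (congrFun hv1 i)
    simpa [Matrix.mulVec, dotProduct, hu, hw] using this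
  have hgu := quadG_clB N r lam μ c γ hlam hμ u
  have hgw := quadG_clB N r lam μ c γ hlam hμ w
  rw [← hB, hBu] at hgu
  rw [← hB, hBw] at hgw
  have hsum : quadG N lam μ u (z.re • u - z.im • w) + quadG N lam μ w (z.re • w + z.im • u)
      = z.re * (quadG N lam μ u u + quadG N lam μ w w) := by
    simp only [quadG, ← Finset.sum_add_distrib, Finset.mul_sum]
    refine Finset.sum_congr rfl fun j _ => ?_
    simp only [Pi.sub_apply, Pi.add_apply, Pi.smul_apply, smul_eq_mul]
    ring
  rw [hgu, hgw, quadW_eq, quadW_eq] at hsum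
  have hpos : 0 < quadW N lam μ u + quadW N lam μ w := by
    by_cases h : u = 0
    · have hw0 : w ≠ 0 := by
        intro hw0
        apply hv0
        ext i
        exact Complex.ext (congrFun h i) (congrFun hw0 i)
      have := quadW_pos N lam μ hlam hμ w hw0
      have := quadW_nonneg N lam μ hlam hμ u
      linarith
    · have := quadW_pos N lam μ hlam hμ u h
      have := quadW_nonneg N lam μ hlam hμ w
      linarith
  have nn : ∀ x : Fin N × Fin 2 → ℝ, ∀ s ∈ Finset.univ, 0 ≤ γ s * ((outC N r c).mulVec x s) ^ 2 :=
    fun x s _ => mul_nonneg (hγ s).le (sq_nonneg _)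
  have nu := Finset.sum_nonneg (nn u)
  have nw := Finset.sum_nonneg (nn w)
  by_contra hre
  push Not at hre
  have hprod : 0 ≤ z.re * (quadW N lam μ u + quadW N lam μ w) := mul_nonneg hre hpos.le
  have su : ∑ s, γ s * ((outC N r c).mulVec u s) ^ 2 = 0 := by linarith
  have sw : ∑ s, γ s * ((outC N r c).mulVec w s) ^ 2 = 0 := by linarith
  have toC : ∀ x : Fin N × Fin 2 → ℝ, ∑ s, γ s * ((outC N r c).mulVec x s) ^ 2 = 0 →
      (outC N r c).mulVec x = 0 := by
    intro x hx
    ext s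
    have := (Finset.sum_eq_zero_iff_of_nonneg (nn x)).mp hx s (Finset.mem_univ _)
    simpa [(hγ s).ne'] using this
  have Cu := toC u su
  have Cw := toC w sw
  have Au : (blockA N lam).mulVec u = z.re • u - z.im • w := by
    rw [← hBu, hB, clB_mulVec, Cu]; simp
  have Aw : (blockA N lam).mulVec w = z.re • w + z.im • u := by
    rw [← hBw, hB, clB_mulVec, Cw]; simp
  have key : ∀ k : ℕ, (outC N r c * blockA N lam ^ k).mulVec u = 0 ∧
      (outC N r c * blockA N lam ^ k).mulVec w = 0 := by
    intro k
    induction k with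
    | zero => simpa using ⟨Cu, Cw⟩
    | succ k ih =>
      rw [pow_succ, ← Matrix.mul_assoc, ← Matrix.mulVec_mulVec u, ← Matrix.mulVec_mulVec w, Au, Aw]
      simp [Matrix.mulVec_sub, Matrix.mulVec_add, Matrix.mulVec_smul, ih.1, ih.2]
  have u0 := obs_inj N r lam c hobs u fun k => (key k).1
  have w0 := obs_inj N r lam c hobs w fun k => (key k).2
  rw [u0, w0] at hpos
  simp [quadW] at hpos

theorem quadW_deriv (N r : ℕ) (lam μ : Fin N → ℝ) (c : Fin (r + 1) → Fin N → ℝ)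
    (γ : Fin (r + 1) → ℝ) (hlam : ∀ j, 0 < lam j) (hμ : ∀ j, 0 < μ j)
    (e : ℝ → Fin N × Fin 2 → ℝ)
    (he : ∀ t : ℝ, HasDerivAt e ((clB N r lam μ c γ).mulVec (e t)) t) (t : ℝ) :
    HasDerivAt (fun t => quadW N lam μ (e t))
      (-∑ s, γ s * ((outC N r c).mulVec (e t) s) ^ 2) t := by
  rw [← quadG_clB N r lam μ c γ hlam hμ]
  have hc := hasDerivAt_pi.mp (he t)
  unfold quadW quadG
  have : HasDerivAt (fun t => ∑ j : Fin N, μ j * ((e t (j, 1)) ^ 2 + lam j * (e t (j, 0)) ^ 2))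
      (∑ j : Fin N, μ j * ((2 * e t (j, 1) * (clB N r lam μ c γ).mulVec (e t) (j, 1))
        + lam j * (2 * e t (j, 0) * (clB N r lam μ c γ).mulVec (e t) (j, 0)))) t := by
    apply HasDerivAt.fun_sum
    intro j _
    apply HasDerivAt.const_mul
    apply HasDerivAt.add
    · have h := (hc (j, 1)).fun_pow 2
      norm_num at h
      exact h
    · apply HasDerivAt.const_mul
      have h := (hc (j, 0)).fun_pow 2
      norm_num at h
      exact h
  refine (this.const_mul (1 / 2)).congr_deriv ?_
  rw [Finset.mul_sum]
  refine Finset.sum_congr rfl fun j _ => by ring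

theorem quadW_anti (N r : ℕ) (lam μ : Fin N → ℝ) (c : Fin (r + 1) → Fin N → ℝ)
    (γ : Fin (r + 1) → ℝ) (hlam : ∀ j, 0 < lam j) (hμ : ∀ j, 0 < μ j) (hγ : ∀ s, 0 < γ s)
    (e : ℝ → Fin N × Fin 2 → ℝ)
    (he : ∀ t : ℝ, HasDerivAt e ((clB N r lam μ c γ).mulVec (e t)) t) :
    Antitone (fun t => quadW N lam μ (e t)) := by
  apply antitone_of_hasDerivAt_nonpos (quadW_deriv N r lam μ c γ hlam hμ e he)
  intro t
  simp only [Pi.zero_apply, neg_nonpos]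
  exact Finset.sum_nonneg fun s _ => mul_nonneg (hγ s).le (sq_nonneg _)

theorem quadW_strict (N r : ℕ) (lam μ : Fin N → ℝ) (c : Fin (r + 1) → Fin N → ℝ)
    (γ : Fin (r + 1) → ℝ) (hlam : ∀ j, 0 < lam j) (hμ : ∀ j, 0 < μ j) (hγ : ∀ s, 0 < γ s)
    (hobs : (obsMat N r lam c).rank = 2 * N)
    (e : ℝ → Fin N × Fin 2 → ℝ)
    (he : ∀ t : ℝ, HasDerivAt e ((clB N r lam μ c γ).mulVec (e t)) t) (h0 : e 0 ≠ 0) :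
    quadW N lam μ (e 1) < quadW N lam μ (e 0) := by
  by_contra hcon
  push Not at hcon
  have anti := quadW_anti N r lam μ c γ hlam hμ hγ e he
  have hconst : ∀ t ∈ Set.Ioo (0 : ℝ) 1, quadW N lam μ (e t) = quadW N lam μ (e 0) := by
    intro t ht
    have h1 := anti ht.1.le
    have h2 := anti ht.2.le
    simp only at h1 h2
    linarith
  have hC : ∀ t ∈ Set.Ioo (0 : ℝ) 1, (outC N r c).mulVec (e t) = 0 := by
    intro t ht
    have hd := quadW_deriv N r lam μ c γ hlam hμ e he t
    have hd2 : HasDerivAt (fun t => quadW N lam μ (e t)) 0 t := by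
      apply (hasDerivAt_const t (quadW N lam μ (e 0))).congr_of_eventuallyEq
      filter_upwards [isOpen_Ioo.mem_nhds ht] with s hs using hconst s hs
    have hz := hd.unique hd2
    rw [neg_eq_zero] at hz
    ext s
    have := (Finset.sum_eq_zero_iff_of_nonneg
      (fun s _ => mul_nonneg (hγ s).le (sq_nonneg _))).mp hz s (Finset.mem_univ _)
    simpa [(hγ s).ne'] using this
  have key : ∀ k : ℕ, ∀ t ∈ Set.Ioo (0 : ℝ) 1,
      (outC N r c * blockA N lam ^ k).mulVec (e t) = 0 := by
    intro k
    induction k with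
    | zero => simpa using hC
    | succ k ih =>
      intro t ht
      have hd : HasDerivAt (fun t => (outC N r c * blockA N lam ^ k).mulVec (e t))
          ((outC N r c * blockA N lam ^ k).mulVec ((clB N r lam μ c γ).mulVec (e t))) t :=
        ((Matrix.mulVecLin (outC N r c * blockA N lam ^ k)).toContinuousLinearMap.hasFDerivAt
          (x := e t)).comp_hasDerivAt t (he t)
      have hd2 : HasDerivAt (fun t => (outC N r c * blockA N lam ^ k).mulVec (e t)) 0 t := by
        apply (hasDerivAt_const t (0 : Fin (r + 1) → ℝ)).congr_of_eventuallyEq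
        filter_upwards [isOpen_Ioo.mem_nhds ht] with s hs using ih s hs
      have hz := hd.unique hd2
      rw [clB_mulVec, hC t ht, Matrix.mulVec_zero, sub_zero, Matrix.mulVec_mulVec] at hz
      rwa [pow_succ, ← Matrix.mul_assoc]
  have hhalf : (1 / 2 : ℝ) ∈ Set.Ioo (0 : ℝ) 1 := by constructor <;> norm_num
  have hz := obs_inj N r lam c hobs (e (1 / 2)) fun k => key k _ hhalf
  have := hconst _ hhalf
  rw [hz] at this
  have hp := quadW_pos N lam μ hlam hμ _ h0
  rw [← this] at hp
  simp [quadW] at hp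

theorem decay_part (N r : ℕ) (lam μ : Fin N → ℝ) (c : Fin (r + 1) → Fin N → ℝ)
    (γ : Fin (r + 1) → ℝ) (hlam : ∀ j, 0 < lam j) (hμ : ∀ j, 0 < μ j) (hγ : ∀ s, 0 < γ s)
    (hobs : (obsMat N r lam c).rank = 2 * N) :
    ∃ M α : ℝ, 0 < M ∧ 0 < α ∧
        ∀ e : ℝ → Fin N × Fin 2 → ℝ,
          (∀ t : ℝ, HasDerivAt e ((clB N r lam μ c γ).mulVec (e t)) t) →
          ∀ t : ℝ, 0 ≤ t → ‖e t‖ ≤ M * Real.exp (-α * t) * ‖e 0‖ := by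
  set L : (Fin N × Fin 2 → ℝ) →L[ℝ] (Fin N × Fin 2 → ℝ) :=
    (Matrix.mulVecLin (clB N r lam μ c γ)).toContinuousLinearMap with hL
  have hLa : ∀ x, L x = (clB N r lam μ c γ).mulVec x := fun x => rfl
  set S : ℝ → (Fin N × Fin 2 → ℝ) →L[ℝ] (Fin N × Fin 2 → ℝ) := fun t => NormedSpace.exp (t • L)
    with hS
  have hS0 : S 0 = 1 := by simp [hS]
  have hSd : ∀ x t, HasDerivAt (fun t => S t x) ((clB N r lam μ c γ).mulVec (S t x)) t := by
    intro x t
    have := (hasDerivAt_exp_smul_const' (𝕂 := ℝ) L t).clm_apply (hasDerivAt_const t x)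
    simpa [hLa] using this
  have Wcont : Continuous (quadW N lam μ) := by unfold quadW; fun_prop
  have Whom : ∀ (a : ℝ) x, quadW N lam μ (a • x) = a ^ 2 * quadW N lam μ x := by
    intro a x
    simp only [quadW, Finset.mul_sum, Pi.smul_apply, smul_eq_mul]
    refine Finset.sum_congr rfl fun j _ => by ring
  have Wpos := quadW_pos N lam μ hlam hμ
  have Wnn := quadW_nonneg N lam μ hlam hμ
  have ncont : Continuous (fun x : Fin N × Fin 2 → ℝ => ‖x‖ ^ 2) := by fun_prop
  have nhom : ∀ (a : ℝ) (x : Fin N × Fin 2 → ℝ), ‖a • x‖ ^ 2 = a ^ 2 * ‖x‖ ^ 2 := by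
    intro a x
    rw [norm_smul, mul_pow, Real.norm_eq_abs, sq_abs]
  obtain ⟨K1, -, hK1⟩ := aux_ratio _ _ Wcont ncont Whom nhom Wpos
  obtain ⟨K2, -, hK2⟩ := aux_ratio _ _ ncont Wcont nhom Whom
    (fun x hx => by have := norm_pos_iff.mpr hx; positivity)
  obtain ⟨ρ0, hρ0, hρ⟩ := aux_ratio (quadW N lam μ) (fun x => quadW N lam μ (S 1 x)) Wcont
    (Wcont.comp (S 1).continuous) Whom (fun a x => by rw [map_smul, Whom]) Wpos
  have hρ1 : ρ0 < 1 := by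
    rcases hρ0 with h | ⟨x, hx, h⟩
    · rw [h]; norm_num
    · rw [h, div_lt_one (Wpos x hx)]
      have := quadW_strict N r lam μ c γ hlam hμ hγ hobs (fun t => S t x) (hSd x)
        (by simpa [hS0] using hx)
      simpa [hS0] using this
  set ρ := max ρ0 (1 / 2) with hρd
  have hρpos : 0 < ρ := lt_of_lt_of_le (by norm_num) (le_max_right _ _)
  have hρlt : ρ < 1 := max_lt hρ1 (by norm_num)
  have hstep : ∀ x, quadW N lam μ (S 1 x) ≤ ρ * quadW N lam μ x := fun x =>
    (hρ x).trans (mul_le_mul_of_nonneg_right (le_max_left _ _) (Wnn x))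
  set Q := max K1 1 * (max K2 1 * ρ⁻¹) with hQ
  have hk1 : (0:ℝ) < max K1 1 := lt_of_lt_of_le one_pos (le_max_right _ _)
  have hk2 : (0:ℝ) < max K2 1 := lt_of_lt_of_le one_pos (le_max_right _ _)
  have hQpos : 0 < Q := by positivity
  have hlog : Real.log ρ < 0 := Real.log_neg hρpos hρlt
  refine ⟨Real.sqrt Q, -Real.log ρ / 2, Real.sqrt_pos.mpr hQpos, by linarith, ?_⟩
  intro e he t ht
  have anti := quadW_anti N r lam μ c γ hlam hμ hγ e he
  have huniq : ∀ s, e (s + 1) = S 1 (e s) := by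
    intro s
    have : (fun t => e (s + t)) = fun t => S t (e s) := by
      apply ODE_solution_unique_univ (v := fun _ x => L x) (s := fun _ => Set.univ)
        (K := ‖L‖₊) (t₀ := 0)
      · intro t; exact L.lipschitz.lipschitzOnWith
      · intro t; exact ⟨(he (s + t)).comp_const_add s t, trivial⟩
      · intro t; exact ⟨hSd (e s) t, trivial⟩
      · simp [hS0]
    exact congrFun this 1
  have hn : ∀ n : ℕ, quadW N lam μ (e n) ≤ ρ ^ n * quadW N lam μ (e 0) := by
    intro n
    induction n with
    | zero => simp
    | succ n ih =>
      push_cast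
      rw [huniq, pow_succ']
      calc _ ≤ ρ * quadW N lam μ (e n) := hstep _
        _ ≤ ρ * (ρ ^ n * quadW N lam μ (e 0)) := by gcongr
        _ = _ := by ring
  have hfl : quadW N lam μ (e t) ≤ ρ ^ ⌊t⌋₊ * quadW N lam μ (e 0) :=
    (anti (Nat.floor_le ht)).trans (hn _)
  have hpow : ρ ^ ⌊t⌋₊ ≤ ρ⁻¹ * Real.exp (Real.log ρ * t) := by
    rw [← Real.rpow_def_of_pos hρpos, ← Real.rpow_natCast, ← Real.rpow_neg_one,
      ← Real.rpow_add hρpos]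
    apply Real.rpow_le_rpow_of_exponent_ge hρpos hρlt.le
    have := Nat.lt_floor_add_one t
    linarith
  have hfin : ‖e t‖ ^ 2 ≤ Q * Real.exp (Real.log ρ * t) * ‖e 0‖ ^ 2 := by
    calc ‖e t‖ ^ 2 ≤ K1 * quadW N lam μ (e t) := hK1 _
      _ ≤ max K1 1 * quadW N lam μ (e t) :=
        mul_le_mul_of_nonneg_right (le_max_left _ _) (Wnn _)
      _ ≤ max K1 1 * (ρ ^ ⌊t⌋₊ * quadW N lam μ (e 0)) := by gcongr
      _ ≤ max K1 1 * ((ρ⁻¹ * Real.exp (Real.log ρ * t)) * (max K2 1 * ‖e 0‖ ^ 2)) := by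
        have h2 : quadW N lam μ (e 0) ≤ max K2 1 * ‖e 0‖ ^ 2 :=
          (hK2 _).trans (mul_le_mul_of_nonneg_right (le_max_left _ _) (by positivity))
        have := Wnn (e 0)
        gcongr
      _ = _ := by rw [hQ]; ring
  apply le_of_sq_le_sq _ (by positivity)
  rw [mul_pow, mul_pow, Real.sq_sqrt hQpos.le, ← Real.exp_nat_mul]
  have hexp : ((2 : ℕ) : ℝ) * (-(-Real.log ρ / 2) * t) = Real.log ρ * t := by
    push_cast
    ring
  rw [hexp]
  exact hfin

theorem stmt8 (N r : ℕ) (lam μ : Fin N → ℝ) (c : Fin (r + 1) → Fin N → ℝ)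
    (γ : Fin (r + 1) → ℝ)
    (hlam : ∀ j, 0 < lam j) (hdist : Function.Injective lam)
    (hμ : ∀ j, 0 < μ j) (hγ : ∀ s, 0 < γ s)
    (hobs : (obsMat N r lam c).rank = 2 * N) :
    (∀ z ∈ spectrum ℂ
        ((blockA N lam - gainF N r lam c γ μ * outC N r c).map (algebraMap ℝ ℂ)),
      z.re < 0)
    ∧ ∃ M α : ℝ, 0 < M ∧ 0 < α ∧
        ∀ e : ℝ → Fin N × Fin 2 → ℝ,
          (∀ t : ℝ, HasDerivAt e
            ((blockA N lam - gainF N r lam c γ μ * outC N r c).mulVec (e t)) t) →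
          ∀ t : ℝ, 0 ≤ t → ‖e t‖ ≤ M * Real.exp (-α * t) * ‖e 0‖ := by
  exact ⟨fun z hz => spec_part N r lam μ c γ hlam hμ hγ hobs z hz,
    decay_part N r lam μ c γ hlam hμ hγ hobs⟩
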